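/- arXiv:2304.10606 — 8 statements merged into one kernel-verified Lean document; each statement's English description precedes it below -/
import Mathlib

section
/- Let c, B, t₀ > 0. Let z : [0,∞) → ℝ be continuously differentiable with |z(s)| ≤ 2c for all s ≥ 0, and let K : [0,∞) → ℝ be continuous such that z′(s) + z(s)² ≥ −2K(s) for all s ≥ 0 and (1/t)·∫₀ᵗ K(s) ds ≤ −B for all t > t₀. Then for every t > max(t₀, 4c/B) one has (1/t)·∫₀ᵗ z(s)² ds ≥ B. -/
open intervalIntegral

/-- Integrating the Riccati-type inequality `z' + z² ≥ -2K` with `|z| ≤ 2c` and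
average of `K` at most `-B`, the average of `z²` is at least `B` for large `t`. -/
theorem riccati_avg_sq_lower_bound
    (c B t₀ : ℝ) (hc : 0 < c) (hB : 0 < B) (ht₀ : 0 < t₀)
    (z z' K : ℝ → ℝ)
    (hderiv : ∀ s : ℝ, 0 ≤ s → HasDerivAt z (z' s) s)
    (hz'cont : ContinuousOn z' (Set.Ici 0))
    (hzbound : ∀ s : ℝ, 0 ≤ s → |z s| ≤ 2 * c)
    (hKcont : ContinuousOn K (Set.Ici 0))
    (hriccati : ∀ s : ℝ, 0 ≤ s → z' s + (z s) ^ 2 ≥ -2 * K s)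
    (havgK : ∀ t : ℝ, t₀ < t → (1 / t) * ∫ s in (0:ℝ)..t, K s ≤ -B) :
    ∀ t : ℝ, max t₀ (4 * c / B) < t →
      B ≤ (1 / t) * ∫ s in (0:ℝ)..t, (z s) ^ 2 := by
  intro t ht
  obtain ⟨htt₀, htc⟩ := max_lt_iff.1 ht
  have ht_pos : 0 < t := ht₀.trans htt₀
  have hct : 4 * c < B * t := by
    rwa [div_lt_iff₀ hB, mul_comm t B] at htc
  have hsub : Set.uIcc 0 t ⊆ Set.Ici 0 := by
    rw [Set.uIcc_of_le ht_pos.le]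
    exact Set.Icc_subset_Ici_self
  have hzcont : ContinuousOn z (Set.Ici 0) := fun s hs =>
    (hderiv s hs).continuousAt.continuousWithinAt
  have hz'int : IntervalIntegrable z' MeasureTheory.volume 0 t :=
    (hz'cont.mono hsub).intervalIntegrable
  have hzsqint : IntervalIntegrable (fun s => z s ^ 2) MeasureTheory.volume 0 t :=
    ((hzcont.pow 2).mono hsub).intervalIntegrable
  have hKint : IntervalIntegrable K MeasureTheory.volume 0 t :=
    (hKcont.mono hsub).intervalIntegrable
  have hftc : ∫ s in (0:ℝ)..t, z' s = z t - z 0 :=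
    integral_eq_sub_of_hasDerivAt (fun s hs => hderiv s (hsub hs)) hz'int
  have hmono : ∫ s in (0:ℝ)..t, -2 * K s ≤ ∫ s in (0:ℝ)..t, (z' s + z s ^ 2) :=
    integral_mono_on ht_pos.le (hKint.const_mul (-2)) (hz'int.add hzsqint)
      fun s hs => hriccati s hs.1
  rw [integral_add hz'int hzsqint, hftc, integral_const_mul] at hmono
  have hK := havgK t htt₀
  rw [one_div_mul_eq_div, div_le_iff₀ ht_pos] at hK
  rw [one_div_mul_eq_div, le_div_iff₀ ht_pos]
  have hz0 := (abs_le.1 (hzbound 0 le_rfl)).1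
  have hzt := (abs_le.1 (hzbound t ht_pos.le)).2
  linarith
end

section
/- Let c, B, t₀ > 0. Let f : [0,∞) → (0,∞) be twice continuously differentiable and nonincreasing, with |f′(t)| ≤ 2c·f(t) for all t ≥ 0, and let K : [0,∞) → ℝ be continuous such that f″(t) ≥ −2K(t)·f(t) for all t ≥ 0 and (1/t)·∫₀ᵗ K(s) ds ≤ −B for all t > t₀. Then f(t) ≤ f(0)·e^{−(B/(2c))·t} for every t > max(t₀, 4c/B). -/
open intervalIntegral

/-- A differentiable function which is antitone on `[0, ∞)` has nonpositive derivative there. -/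
theorem AntitoneOn.hasDerivAt_nonpos_of_Ici {f : ℝ → ℝ} {f' t : ℝ}
    (hf : AntitoneOn f (Set.Ici 0)) (ht : 0 ≤ t) (h : HasDerivAt f f' t) : f' ≤ 0 := by
  rw [← h.hasDerivWithinAt.derivWithin (uniqueDiffOn_Ici 0 t ht)]
  exact hf.derivWithin_nonpos

/-- The primitive of a function continuous on `[0, ∞)` is differentiable on `(0, ∞)`. -/
theorem ContinuousOn.hasDerivAt_integral_of_Ici {K : ℝ → ℝ} (hK : ContinuousOn K (Set.Ici 0))
    {s : ℝ} (hs : 0 < s) : HasDerivAt (fun x => ∫ y in (0:ℝ)..x, K y) (K s) s := by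
  apply integral_hasDerivAt_right
  · refine (hK.mono fun x hx => ?_).intervalIntegrable
    rw [Set.uIcc_of_le hs.le] at hx
    exact hx.1
  · exact (hK.mono Set.Ioi_subset_Ici_self).stronglyMeasurableAtFilter isOpen_Ioi s hs
  · exact hK.continuousAt (Ici_mem_nhds hs)

/-- The primitive of a function continuous on `[0, ∞)` is continuous on `[0, t]`. -/
theorem ContinuousOn.continuousOn_integral_of_Ici {K : ℝ → ℝ} (hK : ContinuousOn K (Set.Ici 0))
    {t : ℝ} (ht : 0 ≤ t) :
    ContinuousOn (fun x => ∫ y in (0:ℝ)..x, K y) (Set.Icc 0 t) := by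
  rw [← Set.uIcc_of_le ht]
  apply continuousOn_primitive_interval
  rw [Set.uIcc_of_le ht]
  exact (hK.mono Set.Icc_subset_Ici_self).integrableOn_Icc

/-- For a positive nonincreasing `f` with `|f'| ≤ 2cf` and `f'' ≥ -2Kf`, the function
`f' / f - 2c log f + 2 ∫ K` is nondecreasing. -/
theorem riccati_log_inequality {c : ℝ} {f f' f'' K : ℝ → ℝ}
    (hderiv : ∀ t : ℝ, 0 ≤ t → HasDerivAt f (f' t) t)
    (hderiv' : ∀ t : ℝ, 0 ≤ t → HasDerivAt f' (f'' t) t)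
    (hfpos : ∀ t : ℝ, 0 ≤ t → 0 < f t)
    (hf'nonpos : ∀ t : ℝ, 0 ≤ t → f' t ≤ 0)
    (hf'bound : ∀ t : ℝ, 0 ≤ t → |f' t| ≤ 2 * c * f t)
    (hKcont : ContinuousOn K (Set.Ici 0))
    (hf'' : ∀ t : ℝ, 0 ≤ t → f'' t ≥ -2 * K t * f t) {t : ℝ} (ht : 0 ≤ t) :
    f' 0 / f 0 - 2 * c * Real.log (f 0) ≤
      f' t / f t - 2 * c * Real.log (f t) + 2 * ∫ s in (0:ℝ)..t, K s := by
  have hlocal (s : ℝ) (hs : 0 ≤ s) : HasDerivAt (fun x => f' x / f x - 2 * c * Real.log (f x))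
      ((f'' s * f s - f' s * f' s) / f s ^ 2 - 2 * c * (f' s / f s)) s :=
    ((hderiv' s hs).div (hderiv s hs) (hfpos s hs).ne').sub
      (((hderiv s hs).log (hfpos s hs).ne').const_mul (2 * c))
  have hmono : MonotoneOn
      (fun x => f' x / f x - 2 * c * Real.log (f x) + 2 * ∫ y in (0:ℝ)..x, K y)
      (Set.Icc 0 t) := by
    refine monotoneOn_of_hasDerivWithinAt_nonneg (convex_Icc 0 t)
      (ContinuousOn.add (fun s hs => (hlocal s hs.1).continuousAt.continuousWithinAt)
        ((hKcont.continuousOn_integral_of_Ici ht).const_mul 2))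
      (f' := fun s => (f'' s * f s - f' s * f' s) / f s ^ 2 - 2 * c * (f' s / f s) + 2 * K s)
      (fun s hs => ?_) (fun s hs => ?_)
    · rw [interior_Icc] at hs
      exact ((hlocal s hs.1.le).add
        ((hKcont.hasDerivAt_integral_of_Ici hs.1).const_mul 2)).hasDerivWithinAt
    · rw [interior_Icc] at hs
      have hpos := hfpos s hs.1.le
      have hlower := neg_le_of_abs_le (hf'bound s hs.1.le)
      have hriccati := hf'' s hs.1.le
      have hnonpos := hf'nonpos s hs.1.le
      have heq : (f'' s * f s - f' s * f' s) / f s ^ 2 - 2 * c * (f' s / f s) + 2 * K s =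
          ((f'' s + 2 * K s * f s) * f s + (-f' s) * (f' s + 2 * c * f s)) / f s ^ 2 := by
        field_simp
        ring
      rw [heq]
      have h₁ : 0 ≤ (f'' s + 2 * K s * f s) * f s := mul_nonneg (by linarith) hpos.le
      have h₂ : 0 ≤ (-f' s) * (f' s + 2 * c * f s) :=
        mul_nonneg (by linarith) (by linarith)
      positivity
  simpa using hmono (Set.left_mem_Icc.2 ht) (Set.right_mem_Icc.2 ht) ht

/-- Exponential decay of a positive nonincreasing function satisfying
`f'' ≥ -2Kf` and `|f'| ≤ 2cf`, when the average of `K` is at most `-B`. -/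
theorem exponential_decay_of_riccati
    (c B t₀ : ℝ) (hc : 0 < c) (hB : 0 < B) (ht₀ : 0 < t₀)
    (f f' f'' K : ℝ → ℝ)
    (hderiv : ∀ t : ℝ, 0 ≤ t → HasDerivAt f (f' t) t)
    (hderiv' : ∀ t : ℝ, 0 ≤ t → HasDerivAt f' (f'' t) t)
    (hf''cont : ContinuousOn f'' (Set.Ici 0))
    (hfpos : ∀ t : ℝ, 0 ≤ t → 0 < f t)
    (hmono : AntitoneOn f (Set.Ici 0))
    (hf'bound : ∀ t : ℝ, 0 ≤ t → |f' t| ≤ 2 * c * f t)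
    (hKcont : ContinuousOn K (Set.Ici 0))
    (hf'' : ∀ t : ℝ, 0 ≤ t → f'' t ≥ -2 * K t * f t)
    (havgK : ∀ t : ℝ, t₀ < t → (1 / t) * ∫ s in (0:ℝ)..t, K s ≤ -B) :
    ∀ t : ℝ, max t₀ (4 * c / B) < t →
      f t ≤ f 0 * Real.exp (-(B / (2 * c)) * t) := by
  intro t ht
  obtain ⟨ht₁, ht₂⟩ := max_lt_iff.1 ht
  have htpos : 0 < t := ht₀.trans ht₁
  have hf'nonpos (s : ℝ) (hs : 0 ≤ s) : f' s ≤ 0 :=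
    hmono.hasDerivAt_nonpos_of_Ici hs (hderiv s hs)
  have hlog := riccati_log_inequality hderiv hderiv' hfpos hf'nonpos hf'bound hKcont hf'' htpos.le
  have hK : ∫ s in (0:ℝ)..t, K s ≤ -B * t := by
    have h := havgK t ht₁
    rwa [one_div_mul_eq_div, div_le_iff₀ htpos] at h
  have hf0 := hfpos 0 le_rfl
  have hft := hfpos t htpos.le
  have hstart : -(2 * c) ≤ f' 0 / f 0 := by
    rw [le_div_iff₀ hf0]
    linarith [neg_le_of_abs_le (hf'bound 0 le_rfl)]
  have hend : f' t / f t ≤ 0 := div_nonpos_of_nonpos_of_nonneg (hf'nonpos t htpos.le) hft.le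
  have hBt : 4 * c < t * B := (div_lt_iff₀ hB).1 ht₂
  rw [← Real.log_le_log_iff hft (by positivity), Real.log_mul hf0.ne' (Real.exp_ne_zero _),
    Real.log_exp]
  have hexp : 2 * c * (-(B / (2 * c)) * t) = -(B * t) := by
    field_simp
  refine le_of_mul_le_mul_left ?_ (show 0 < 2 * c by positivity)
  linarith
end

section
/- Let 0 < C₁ < C₂, let a : [0,∞) → ℝ be continuous with C₁/2 < a(t) < C₂/2 for all t ≥ 0, and let b : [0,∞) → ℝ be continuously differentiable with b′(t) = a(t)·(1 − b(t)²) for all t ≥ 0 and |b(0)| < 1. Set B₀ = (1 + b(0))/(1 − b(0)). Then |b(t)| < 1 for all t ≥ 0, and for every t > 0 one has 1 − 2/(B₀·e^{C₁ t} + 1) < b(t) < 1 − 2/(B₀·e^{C₂ t} + 1). -/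
/-- A solution of the linear equation `u' = c(t) u` with positive initial value stays positive. -/
theorem pos_of_hasDerivAt_mul_self {c u : ℝ → ℝ} (hc : ContinuousOn c (Set.Ici 0))
    (hu : ∀ t, 0 ≤ t → HasDerivAt u (c t * u t) t) (hu0 : 0 < u 0) {t : ℝ} (ht : 0 ≤ t) :
    0 < u t := by
  have hcont : Continuous fun s => c (max s 0) :=
    hc.comp_continuous (by fun_prop) fun s => le_max_right s 0
  set F : ℝ → ℝ := fun t => ∫ s in (0 : ℝ)..t, c (max s 0)
  have hF : ∀ s, 0 ≤ s → HasDerivAt F (c s) s := fun s hs => by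
    have h := hcont.integral_hasStrictDerivAt 0 s |>.hasDerivAt
    rwa [max_eq_left hs] at h
  have hder : ∀ s, 0 ≤ s → HasDerivAt (fun s => u s * Real.exp (-F s)) 0 s := fun s hs => by
    refine ((hu s hs).mul (hF s hs).neg.exp).congr_deriv ?_
    ring
  have hconst : u t * Real.exp (-F t) = u 0 * Real.exp (-F 0) :=
    constant_of_has_deriv_right_zero
      (fun s hs => (hder s hs.1).continuousAt.continuousWithinAt)
      (fun s hs => (hder s hs.1).hasDerivWithinAt) t ⟨ht, le_rfl⟩
  have hpos : 0 < u t * Real.exp (-F t) := hconst ▸ mul_pos hu0 (Real.exp_pos _)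
  exact pos_of_mul_pos_left hpos (Real.exp_pos _).le

/-- A positive solution of `f' = c(t) f` with `C < c` grows strictly faster than `exp (C t)`. -/
theorem mul_exp_lt_of_hasDerivAt_mul_self {c f : ℝ → ℝ} {C : ℝ}
    (hf : ∀ t, 0 ≤ t → HasDerivAt f (c t * f t) t) (hpos : ∀ t, 0 ≤ t → 0 < f t)
    (hC : ∀ t, 0 ≤ t → C < c t) {t : ℝ} (ht : 0 < t) :
    f 0 * Real.exp (C * t) < f t := by
  have hder : ∀ s, 0 ≤ s →
      HasDerivAt (fun s => f s * Real.exp (-(C * s))) ((c s - C) * f s * Real.exp (-(C * s))) s :=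
    fun s hs => by
      refine ((hf s hs).mul ((hasDerivAt_id s).const_mul C).neg.exp).congr_deriv ?_
      simp only [id, Pi.neg_apply]
      ring
  have hmono : StrictMonoOn (fun s => f s * Real.exp (-(C * s))) (Set.Ici 0) := by
    refine strictMonoOn_of_deriv_pos (convex_Ici 0)
      (fun s hs => (hder s hs).continuousAt.continuousWithinAt) fun s hs => ?_
    have hs' : 0 ≤ s := interior_subset hs
    rw [(hder s hs').deriv]
    exact mul_pos (mul_pos (sub_pos.2 (hC s hs')) (hpos s hs')) (Real.exp_pos _)
  have h := hmono Set.self_mem_Ici ht.le ht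
  simp only [mul_zero, neg_zero, Real.exp_zero, mul_one] at h
  rwa [Real.exp_neg, ← div_eq_mul_inv, lt_div_iff₀ (Real.exp_pos _)] at h

/-- Two-sided bound for solutions of the Riccati-type equation `b' = a(t)(1 - b²)`
with `C₁/2 < a < C₂/2` and `|b 0| < 1`. -/
theorem riccati_two_sided_bound
    (C₁ C₂ : ℝ) (hC₁ : 0 < C₁) (hC : C₁ < C₂)
    (a b : ℝ → ℝ)
    (hacont : ContinuousOn a (Set.Ici 0))
    (habound : ∀ t : ℝ, 0 ≤ t → C₁ / 2 < a t ∧ a t < C₂ / 2)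
    (hb : ∀ t : ℝ, 0 ≤ t → HasDerivAt b (a t * (1 - (b t) ^ 2)) t)
    (hb0 : |b 0| < 1)
    (B₀ : ℝ) (hB₀ : B₀ = (1 + b 0) / (1 - b 0)) :
    (∀ t : ℝ, 0 ≤ t → |b t| < 1) ∧
      ∀ t : ℝ, 0 < t →
        1 - 2 / (B₀ * Real.exp (C₁ * t) + 1) < b t ∧
        b t < 1 - 2 / (B₀ * Real.exp (C₂ * t) + 1) := by
  have hbcont : ContinuousOn b (Set.Ici 0) :=
    fun t ht => (hb t ht).continuousAt.continuousWithinAt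
  obtain ⟨hl0, hr0⟩ := abs_lt.1 hb0
  have hminus : ∀ t, 0 ≤ t → 0 < 1 - b t := fun t ht => by
    refine pos_of_hasDerivAt_mul_self (c := fun t => -(a t * (1 + b t))) (u := fun t => 1 - b t)
      (by fun_prop) (fun s hs => ?_) (by linarith) ht
    exact ((hb s hs).const_sub 1).congr_deriv (by ring)
  have hplus : ∀ t, 0 ≤ t → 0 < 1 + b t := fun t ht => by
    refine pos_of_hasDerivAt_mul_self (c := fun t => a t * (1 - b t)) (u := fun t => 1 + b t)
      (by fun_prop) (fun s hs => ?_) (by linarith) ht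
    exact ((hb s hs).const_add 1).congr_deriv (by ring)
  have hB₀pos : 0 < B₀ := hB₀ ▸ div_pos (hplus 0 le_rfl) (hminus 0 le_rfl)
  refine ⟨fun t ht => abs_lt.2 ⟨by linarith [hplus t ht], by linarith [hminus t ht]⟩,
    fun t ht => ⟨?_, ?_⟩⟩
  · have h := mul_exp_lt_of_hasDerivAt_mul_self (c := fun t => 2 * a t) (C := C₁)
      (f := fun t => (1 + b t) / (1 - b t))
      (fun s hs => (((hb s hs).const_add 1).div ((hb s hs).const_sub 1)
        (hminus s hs).ne').congr_deriv (by
          have := (hminus s hs).ne'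
          field_simp
          ring))
      (fun s hs => div_pos (hplus s hs) (hminus s hs))
      (fun s hs => by linarith [(habound s hs).1]) ht
    simp only [← hB₀] at h
    rw [lt_div_iff₀ (hminus t ht.le)] at h
    have hE : 0 < B₀ * Real.exp (C₁ * t) + 1 := by positivity
    rw [sub_lt_comm, lt_div_iff₀ hE]
    linarith
  · have h := mul_exp_lt_of_hasDerivAt_mul_self (c := fun t => -(2 * a t)) (C := -C₂)
      (f := fun t => (1 - b t) / (1 + b t))
      (fun s hs => (((hb s hs).const_sub 1).div ((hb s hs).const_add 1)
        (hplus s hs).ne').congr_deriv (by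
          have := (hplus s hs).ne'
          field_simp
          ring))
      (fun s hs => div_pos (hminus s hs) (hplus s hs))
      (fun s hs => by linarith [(habound s hs).2]) ht
    have hinv : (1 - b 0) / (1 + b 0) = B₀⁻¹ := by rw [hB₀, inv_div]
    simp only [hinv] at h
    rw [neg_mul, Real.exp_neg, ← mul_inv, lt_div_iff₀ (hplus t ht.le),
      inv_mul_lt_iff₀ (by positivity)] at h
    have hE : 0 < B₀ * Real.exp (C₂ * t) + 1 := by positivity
    rw [lt_sub_comm, div_lt_iff₀ hE]
    linarith
end

section
/- Let 0 < C₁ < C₂, let a : [0,∞) → ℝ be continuous with C₁/2 < a(t) < C₂/2 for all t ≥ 0, and let b : [0,∞) → ℝ be continuously differentiable with b′(t) = a(t)·(1 − b(t)²) for all t ≥ 0 and |b(0)| < 1. Then b is strictly increasing on [0,∞) and b(t) → 1 as t → +∞. -/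
/-- A solution of a scalar linear equation `w' = c(t) w` with `c` continuous that starts positive
stays positive. -/
theorem pos_of_hasDerivAt_mul {c w : ℝ → ℝ} (hc : ContinuousOn c (Set.Ici 0))
    (hw : ∀ t : ℝ, 0 ≤ t → HasDerivAt w (c t * w t) t) (h0 : 0 < w 0) {T : ℝ} (hT : 0 ≤ T) :
    0 < w T := by
  have hwc : ContinuousOn w (Set.Ici 0) := fun t ht => (hw t ht).continuousAt.continuousWithinAt
  have hne : ∀ s : ℝ, 0 ≤ s → w s ≠ 0 := by
    intro s hs hws
    obtain ⟨K, hK⟩ := isCompact_Icc.exists_bound_of_continuousOn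
      (hc.mono (Set.Icc_subset_Ici_self : Set.Icc 0 s ⊆ Set.Ici 0))
    have hder : ∀ t : ℝ, 0 ≤ t → HasDerivAt (fun t => w t ^ 2 * Real.exp (2 * K * t))
        (2 * (c t + K) * w t ^ 2 * Real.exp (2 * K * t)) t := by
      intro t ht
      have := ((hw t ht).pow 2).mul (((hasDerivAt_id t).const_mul (2 * K)).exp)
      refine this.congr_deriv ?_
      simp
      ring
    have hmono : MonotoneOn (fun t => w t ^ 2 * Real.exp (2 * K * t)) (Set.Icc 0 s) := by
      refine monotoneOn_of_deriv_nonneg (convex_Icc 0 s)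
        (fun t ht => (hder t ht.1).continuousAt.continuousWithinAt)
        (fun t ht => (hder t (interior_subset ht).1).differentiableAt.differentiableWithinAt) ?_
      intro t ht
      have ht' := interior_subset ht
      rw [(hder t ht'.1).deriv]
      have h1 : 0 ≤ c t + K := by
        have := (abs_le.mp (hK t ht')).1
        linarith
      positivity
    have := hmono (Set.left_mem_Icc.mpr hs) (Set.right_mem_Icc.mpr hs) hs
    simp [hws] at this
    exact h0.ne' this
  by_contra! hle
  obtain ⟨s, hs, hs0⟩ := intermediate_value_Icc' hT (hwc.mono Set.Icc_subset_Ici_self) ⟨hle, h0.le⟩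
  exact hne s hs.1 hs0

/-- A solution of `b' = a(t)(1 - b²)` with `C₁/2 < a < C₂/2` and `|b 0| < 1`
is strictly increasing on `[0,∞)` and tends to `1` at `+∞`. -/
theorem riccati_strictMono_tendsto_one
    (C₁ C₂ : ℝ) (hC₁ : 0 < C₁) (hC : C₁ < C₂)
    (a b : ℝ → ℝ)
    (hacont : ContinuousOn a (Set.Ici 0))
    (habound : ∀ t : ℝ, 0 ≤ t → C₁ / 2 < a t ∧ a t < C₂ / 2)
    (hb : ∀ t : ℝ, 0 ≤ t → HasDerivAt b (a t * (1 - (b t) ^ 2)) t)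
    (hb0 : |b 0| < 1) :
    StrictMonoOn b (Set.Ici 0) ∧
      Filter.Tendsto b Filter.atTop (nhds 1) := by
  have hbc : ContinuousOn b (Set.Ici 0) := fun t ht => (hb t ht).continuousAt.continuousWithinAt
  have hpos : ∀ t : ℝ, 0 ≤ t → 0 < 1 - b t ^ 2 := by
    intro t ht
    refine pos_of_hasDerivAt_mul (c := fun t => -2 * a t * b t) (w := fun t => 1 - b t ^ 2)
      ((continuousOn_const.mul hacont).mul hbc) (fun s hs => ?_) ?_ ht
    · refine (((hb s hs).pow 2).const_sub 1).congr_deriv ?_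
      simp
      ring
    · exact sub_pos.mpr ((sq_lt_one_iff_abs_lt_one _).mpr hb0)
  have hlt : ∀ t : ℝ, 0 ≤ t → -1 < b t ∧ b t < 1 := fun t ht =>
    abs_lt.mp ((sq_lt_one_iff_abs_lt_one _).mp (sub_pos.mp (hpos t ht)))
  have hmono : StrictMonoOn b (Set.Ici 0) := by
    refine strictMonoOn_of_deriv_pos (convex_Ici 0) hbc fun t ht => ?_
    have ht' : 0 ≤ t := interior_subset ht
    rw [(hb t ht').deriv]
    exact mul_pos (by linarith [(habound t ht').1]) (hpos t ht')
  refine ⟨hmono, ?_⟩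
  set k : ℝ := C₁ / 2 * (1 + b 0) with hk
  have hkpos : 0 < k := mul_pos (by linarith) (by linarith [(hlt 0 le_rfl).1])
  have hder : ∀ t : ℝ, 0 ≤ t → HasDerivAt (fun t => (1 - b t) * Real.exp (k * t))
      ((k - a t * (1 + b t)) * ((1 - b t) * Real.exp (k * t))) t := by
    intro t ht
    refine (((hb t ht).const_sub 1).mul (((hasDerivAt_id t).const_mul k).exp)).congr_deriv ?_
    simp
    ring
  have hanti : AntitoneOn (fun t => (1 - b t) * Real.exp (k * t)) (Set.Ici 0) := by
    refine antitoneOn_of_deriv_nonpos (convex_Ici 0)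
      (fun t ht => (hder t ht).continuousAt.continuousWithinAt)
      (fun t ht => (hder t (interior_subset ht)).differentiableAt.differentiableWithinAt) ?_
    intro t ht
    have ht' : 0 ≤ t := interior_subset ht
    rw [(hder t ht').deriv]
    have hle : b 0 ≤ b t := hmono.monotoneOn Set.self_mem_Ici ht' ht'
    have hka : k ≤ a t * (1 + b t) :=
      mul_le_mul (habound t ht').1.le (by linarith) (by linarith [(hlt 0 le_rfl).1])
        (by linarith [(habound t ht').1])
    exact mul_nonpos_of_nonpos_of_nonneg (by linarith)
      (mul_nonneg (by linarith [(hlt t ht').2]) (Real.exp_pos _).le)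
  have hlow : ∀ t : ℝ, 0 ≤ t → 1 - (1 - b 0) * Real.exp (-(k * t)) ≤ b t := by
    intro t ht
    have h := hanti Set.self_mem_Ici ht ht
    simp only [mul_zero, Real.exp_zero, mul_one] at h
    rw [← le_div_iff₀ (Real.exp_pos _), div_eq_mul_inv, ← Real.exp_neg] at h
    linarith
  have hlim : Filter.Tendsto (fun t => 1 - (1 - b 0) * Real.exp (-(k * t))) Filter.atTop
      (nhds 1) := by
    simpa using ((Real.tendsto_exp_neg_atTop_nhds_zero.comp
      (Filter.tendsto_id.const_mul_atTop hkpos)).const_mul (1 - b 0)).const_sub 1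
  refine tendsto_of_tendsto_of_tendsto_of_le_of_le' hlim tendsto_const_nhds ?_ ?_
  · filter_upwards [Filter.eventually_ge_atTop 0] with t ht using hlow t ht
  · filter_upwards [Filter.eventually_ge_atTop 0] with t ht using (hlt t ht).2.le
end

section
/- Let 0 < C₁ < C₂, let a : [0,∞) → ℝ be continuous with C₁/2 < a(t) < C₂/2 for all t ≥ 0, and let b : [0,∞) → ℝ be continuously differentiable with b′(t) = a(t)·(1 − b(t)²) for all t ≥ 0 and −1/2 ≤ b(0) < 1/2. Then there exists a unique T₁ > 0 with b(T₁) = 1/2, and T₁ < (2/C₁)·log 3. -/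
/-- A solution of `b' = a (1 - b²)` with `a > 0` that starts at or above a level `c ∈ (-1, 1)`
lies strictly above `c` at every later time. -/
theorem riccati_lt_of_le {a b : ℝ → ℝ} (ha : ∀ t, 0 ≤ t → 0 < a t)
    (hb : ∀ t, 0 ≤ t → HasDerivAt b (a t * (1 - b t ^ 2)) t)
    {c s t : ℝ} (hc : -1 < c) (hc' : c < 1) (hs : 0 ≤ s) (hst : s < t) (hbs : c ≤ b s) :
    c < b t := by
  have weak : ∀ x ∈ Set.Icc s t, -b x ≤ -c := by
    refine fun x hx ↦ image_le_of_deriv_right_lt_deriv_boundary'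
      (f' := fun x ↦ -(a x * (1 - b x ^ 2))) (B := fun _ ↦ -c) (B' := fun _ ↦ 0)
      (fun x hx ↦ (hb x (hs.trans hx.1)).continuousAt.neg.continuousWithinAt)
      (fun x hx ↦ (hb x (hs.trans hx.1)).neg.hasDerivWithinAt) (by simpa using hbs)
      continuousOn_const (fun x _ ↦ hasDerivWithinAt_const x _ _) (fun x hx h ↦ ?_) hx
    have hbx : b x = c := neg_inj.mp h
    rw [hbx]
    exact neg_neg_of_pos (mul_pos (ha x (hs.trans hx.1)) (by nlinarith))
  by_contra! hle
  have hbt : b t = c := le_antisymm hle (neg_le_neg_iff.mp (weak t ⟨hst.le, le_rfl⟩))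
  have ht : 0 ≤ t := hs.trans hst.le
  have hslope := (hasDerivAt_iff_tendsto_slope_left_right.mp (hb t ht)).1
  have hpos : 0 < a t * (1 - b t ^ 2) := mul_pos (ha t ht) (by rw [hbt]; nlinarith)
  obtain ⟨x, hx, hxs, hxt⟩ := ((hslope.eventually_const_lt hpos).and
    (Ioo_mem_nhdsLT hst)).exists
  rw [slope_comm, slope_def_field] at hx
  have hbx := weak x ⟨hxs.le, hxt.le⟩
  exact absurd hx (not_lt.mpr (div_nonpos_of_nonpos_of_nonneg (by linarith) (by linarith)))

/-- Hitting-time estimate: if `b' = a(t)(1 - b²)` with `C₁/2 < a < C₂/2` and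
`-1/2 ≤ b 0 < 1/2`, then there is a unique `T₁ > 0` with `b T₁ = 1/2`,
and `T₁ < (2/C₁) log 3`. -/
theorem riccati_hitting_time
    (C₁ C₂ : ℝ) (hC₁ : 0 < C₁) (hC : C₁ < C₂)
    (a b : ℝ → ℝ)
    (hacont : ContinuousOn a (Set.Ici 0))
    (habound : ∀ t : ℝ, 0 ≤ t → C₁ / 2 < a t ∧ a t < C₂ / 2)
    (hb : ∀ t : ℝ, 0 ≤ t → HasDerivAt b (a t * (1 - (b t) ^ 2)) t)
    (hb0l : -(1 / 2) ≤ b 0) (hb0r : b 0 < 1 / 2) :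
    ∃ T₁ : ℝ, 0 < T₁ ∧ b T₁ = 1 / 2 ∧ T₁ < (2 / C₁) * Real.log 3 ∧
      ∀ T : ℝ, 0 < T → b T = 1 / 2 → T = T₁ := by
  have ha : ∀ t, 0 ≤ t → 0 < a t := fun t ht ↦ by linarith [(habound t ht).1]
  have hlog : 0 < Real.log 3 := Real.log_pos (by norm_num)
  set S := (2 / C₁) * Real.log 3 with hS
  have hSpos : 0 < S := by positivity
  have hlower : ∀ t, 0 ≤ t → -(1 / 2) ≤ b t := by
    intro t ht
    rcases ht.eq_or_lt with rfl | ht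
    · exact hb0l
    · exact (riccati_lt_of_le ha hb (by norm_num) (by norm_num) le_rfl ht hb0l).le
  have hexists : ∃ t ∈ Set.Ioo 0 S, b t = 1 / 2 := by
    by_contra! hne
    have hupper : ∀ t ∈ Set.Icc 0 S, b t ≤ 1 / 2 := by
      intro t ht
      by_contra! hlt
      obtain ⟨x, hx, hbx⟩ := intermediate_value_Ioo ht.1
        (fun x hx ↦ (hb x hx.1).continuousAt.continuousWithinAt) ⟨hb0r, hlt⟩
      exact hne x ⟨hx.1, hx.2.trans_le ht.2⟩ hbx
    have hderiv : ∀ t ∈ Set.Icc 0 S,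
        HasDerivAt (fun t ↦ Real.log (1 + b t) - Real.log (1 - b t)) (2 * a t) t := by
      intro t ht
      have h₁ : 1 + b t ≠ 0 := by linarith [hlower t ht.1]
      have h₂ : 1 - b t ≠ 0 := by linarith [hupper t ht]
      refine ((((hb t ht.1).const_add 1).log h₁).sub
        (((hb t ht.1).const_sub 1).log h₂)).congr_deriv ?_
      field_simp
      ring
    obtain ⟨x, hx, hslope⟩ := exists_hasDerivAt_eq_slope _ _ hSpos
      (fun t ht ↦ (hderiv t ht).continuousAt.continuousWithinAt)
      (fun t ht ↦ hderiv t ⟨ht.1.le, ht.2.le⟩)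
    have hgrowth : 2 * Real.log 3 < 2 * a x * S := by
      have : C₁ * S = 2 * Real.log 3 := by rw [hS]; field_simp
      nlinarith [(habound x hx.1.le).1]
    rw [eq_div_iff (by linarith), sub_zero] at hslope
    have hu := hupper S ⟨hSpos.le, le_rfl⟩
    have hl := hlower S hSpos.le
    have hend : Real.log (1 + b S) ≤ Real.log 3 + Real.log (1 - b S) := by
      rw [← Real.log_mul (by norm_num) (by linarith)]
      exact Real.log_le_log (by linarith) (by linarith)
    have hstart : Real.log (1 - b 0) ≤ Real.log 3 + Real.log (1 + b 0) := by
      rw [← Real.log_mul (by norm_num) (by linarith)]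
      exact Real.log_le_log (by linarith) (by linarith)
    linarith
  obtain ⟨T₁, hT₁, hbT₁⟩ := hexists
  refine ⟨T₁, hT₁.1, hbT₁, hT₁.2, fun T hT hbT ↦ ?_⟩
  rcases lt_trichotomy T T₁ with h | h | h
  · exact absurd hbT₁
      (riccati_lt_of_le ha hb (by norm_num) (by norm_num) hT.le h hbT.ge).ne'
  · exact h
  · exact absurd hbT
      (riccati_lt_of_le ha hb (by norm_num) (by norm_num) hT₁.1.le h hbT₁.ge).ne'
end

section
/- Let h : ℝ → ℝ be a continuous, nonnegative function that is periodic with period T > 0, and set η = ∫₀ᵀ h(s) ds; assume η > 0. Let x : [0,∞) → ℝ be continuously differentiable with 1/2 < x′(s) < 1 for all s > 0. Then for every t > 4T, (1/t)·∫₀ᵗ h(x(s))·x′(s)² ds ≥ η/(16T). -/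
open intervalIntegral

lemma Function.Periodic.nat_mul_integral_le_integral {h : ℝ → ℝ} {T a b : ℝ}
    (hper : Function.Periodic h T) (hT : 0 < T) (hcont : Continuous h) (hnn : ∀ u, 0 ≤ h u)
    (n : ℕ) (hab : a + n * T ≤ b) :
    n * ∫ s in (0 : ℝ)..T, h s ≤ ∫ s in a..b, h s := by
  have hint : ∀ c d, IntervalIntegrable h MeasureTheory.volume c d :=
    fun c d => hcont.intervalIntegrable c d
  have hperiods := hper.intervalIntegral_add_zsmul_eq (n : ℤ) a hint
  rw [hper.intervalIntegral_add_eq a 0] at hperiods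
  simp only [zero_add, zsmul_eq_mul, Int.cast_natCast] at hperiods
  rw [← hperiods]
  have hnT : (0 : ℝ) ≤ n * T := by positivity
  exact integral_mono_interval le_rfl (by linarith) hab
    (Filter.Eventually.of_forall hnn) (hint a b)

/-- Case 2 estimate: if `1/2 < x' < 1` on `(0,∞)`, then for `t > 4T` the average
of `h(x(s)) x'(s)²` over `[0,t]` is at least `η/(16T)`. -/
theorem avg_along_increasing_lower_bound
    (h : ℝ → ℝ) (T : ℝ) (hT : 0 < T)
    (hcont : Continuous h) (hnn : ∀ u : ℝ, 0 ≤ h u)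
    (hper : Function.Periodic h T)
    (η : ℝ) (hη : η = ∫ s in (0:ℝ)..T, h s) (hηpos : 0 < η)
    (x x' : ℝ → ℝ)
    (hx : ∀ s : ℝ, 0 ≤ s → HasDerivAt x (x' s) s)
    (hx'cont : ContinuousOn x' (Set.Ici 0))
    (hx'bound : ∀ s : ℝ, 0 < s → 1 / 2 < x' s ∧ x' s < 1) :
    ∀ t : ℝ, 4 * T < t →
      η / (16 * T) ≤ (1 / t) * ∫ s in (0:ℝ)..t, h (x s) * (x' s) ^ 2 := by
  intro t ht
  have ht0 : 0 < t := by linarith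
  have hIcc : Set.uIcc 0 t = Set.Icc 0 t := Set.uIcc_of_le ht0.le
  have hxcont : ContinuousOn x (Set.uIcc 0 t) := fun s hs =>
    (hx s (hIcc ▸ hs).1).continuousAt.continuousWithinAt
  have hx'c : ContinuousOn x' (Set.uIcc 0 t) :=
    hx'cont.mono fun s hs => (hIcc ▸ hs).1
  have hsubst : ∫ s in (0:ℝ)..t, h (x s) * x' s = ∫ u in x 0..x t, h u :=
    integral_comp_mul_deriv (fun s hs => hx s (hIcc ▸ hs).1) hx'c hcont
  have hgrowth : x 0 + t / 2 ≤ x t := by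
    obtain ⟨c, hc, hslope⟩ := exists_hasDerivAt_eq_slope x x' ht0 (hIcc ▸ hxcont)
      fun s hs => hx s hs.1.le
    have hc' := (hx'bound c hc.1).1
    rw [hslope, sub_zero, lt_div_iff₀ ht0] at hc'
    linarith
  have hhx : ContinuousOn (fun s => h (x s)) (Set.uIcc 0 t) := hcont.comp_continuousOn hxcont
  have hmono : 1 / 2 * ∫ s in (0:ℝ)..t, h (x s) * x' s ≤
      ∫ s in (0:ℝ)..t, h (x s) * (x' s) ^ 2 := by
    rw [← integral_const_mul]
    refine integral_mono_on_of_le_Ioo ht0.le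
      ((hhx.mul hx'c).intervalIntegrable.const_mul _)
      (hhx.mul (hx'c.pow 2)).intervalIntegrable fun s hs => ?_
    have hs' := (hx'bound s hs.1).1
    have hsq : 1 / 2 * x' s ≤ x' s ^ 2 := by nlinarith
    linarith [mul_le_mul_of_nonneg_left hsq (hnn (x s))]
  set n := ⌊t / (2 * T)⌋₊
  have hn_le : (n : ℝ) * (2 * T) ≤ t :=
    (le_div_iff₀ (by positivity)).1 (Nat.floor_le (by positivity))
  have hn_lt : t < (n + 1) * (2 * T) :=
    (div_lt_iff₀ (by positivity)).1 (Nat.lt_floor_add_one _)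
  have hperiods := hper.nat_mul_integral_le_integral (a := x 0) (b := x t) hT hcont hnn n
    (by linarith)
  rw [← hη, ← hsubst] at hperiods
  rw [one_div_mul_eq_div, div_le_div_iff₀ (by positivity) ht0]
  have htn : t ≤ n * (8 * T) := by linarith
  have hηt : η * t ≤ n * η * (8 * T) := by linarith [mul_le_mul_of_nonneg_left htn hηpos.le]
  have hηI : n * η ≤ 2 * ∫ s in (0:ℝ)..t, h (x s) * (x' s) ^ 2 := by linarith
  linarith [mul_le_mul_of_nonneg_right hηI (by positivity : 0 ≤ 8 * T)]
end

section
/- Let h : ℝ → ℝ be a continuous, nonnegative function that is periodic with period T > 0, and set η = ∫₀ᵀ h(s) ds; assume η > 0. Let t > 4T and let x : [0,t] → ℝ be continuously differentiable with −1 < x′(s) < −1/2 for all s ∈ (0,t]. Then (1/t)·∫₀ᵗ h(x(s))·x′(s)² ds ≥ η/(16T). -/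
open intervalIntegral

/-- A nonnegative continuous periodic function has integral at least `n` times its integral over
one period on any interval of length at least `n` periods. -/
theorem nat_mul_integral_le_of_periodic {h : ℝ → ℝ} {T : ℝ} (hcont : Continuous h)
    (hnn : ∀ u, 0 ≤ h u) (hT : 0 ≤ T) (hper : Function.Periodic h T) {a b : ℝ} {n : ℕ}
    (hab : a + n * T ≤ b) :
    n * (∫ s in (0:ℝ)..T, h s) ≤ ∫ u in a..b, h u := by
  have hint : ∀ c d : ℝ, IntervalIntegrable h MeasureTheory.volume c d :=
    fun c d => hcont.intervalIntegrable c d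
  have hsum := hper.intervalIntegral_add_zsmul_eq n a hint
  rw [hper.intervalIntegral_add_eq a 0] at hsum
  simp only [zsmul_eq_mul, Int.cast_natCast, zero_add] at hsum
  rw [← hsum]
  have hnT : 0 ≤ (n : ℝ) * T := by positivity
  exact integral_mono_interval le_rfl (by linarith) hab
    (Filter.Eventually.of_forall hnn) (hint _ _)

/-- Case 4 estimate: if `-1 < x' < -1/2` on `(0,t]` and `t > 4T`, then the average
of `h(x(s)) x'(s)²` over `[0,t]` is at least `η/(16T)`. -/
theorem avg_along_decreasing_lower_bound
    (h : ℝ → ℝ) (T : ℝ) (hT : 0 < T)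
    (hcont : Continuous h) (hnn : ∀ u : ℝ, 0 ≤ h u)
    (hper : Function.Periodic h T)
    (η : ℝ) (hη : η = ∫ s in (0:ℝ)..T, h s) (hηpos : 0 < η)
    (t : ℝ) (ht : 4 * T < t)
    (x x' : ℝ → ℝ)
    (hx : ∀ s ∈ Set.Icc (0:ℝ) t, HasDerivAt x (x' s) s)
    (hx'cont : ContinuousOn x' (Set.Icc 0 t))
    (hx'bound : ∀ s ∈ Set.Ioc (0:ℝ) t, -1 < x' s ∧ x' s < -(1 / 2)) :
    η / (16 * T) ≤ (1 / t) * ∫ s in (0:ℝ)..t, h (x s) * (x' s) ^ 2 := by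
  have htpos : 0 < t := by linarith
  have huIcc : Set.uIcc 0 t = Set.Icc 0 t := Set.uIcc_of_le htpos.le
  have hxcont : ContinuousOn x (Set.Icc 0 t) :=
    fun s hs => (hx s hs).continuousAt.continuousWithinAt
  have hhx : ContinuousOn (fun s => h (x s)) (Set.Icc 0 t) := hcont.comp_continuousOn hxcont
  have hsubst : ∫ s in (0:ℝ)..t, h (x s) * x' s = ∫ u in x 0..x t, h u :=
    integral_comp_mul_deriv (fun s hs => hx s (huIcc ▸ hs)) (huIcc.symm ▸ hx'cont) hcont
  have hdrop : x t ≤ x 0 - t / 2 := by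
    obtain ⟨c, hc, hslope⟩ := exists_hasDerivAt_eq_slope x x' htpos hxcont
      (fun s hs => hx s (Set.Ioo_subset_Icc_self hs))
    have hlt := (hx'bound c (Set.Ioo_subset_Ioc_self hc)).2
    rw [hslope, sub_zero, div_lt_iff₀ htpos] at hlt
    linarith
  have hlower : (1 / 2) * ∫ u in x t..x 0, h u ≤ ∫ s in (0:ℝ)..t, h (x s) * (x' s) ^ 2 := by
    rw [integral_symm, ← hsubst, mul_neg, ← neg_mul, ← integral_const_mul]
    refine integral_mono_on_of_le_Ioo htpos.le ?_ ?_ fun s hs => ?_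
    · exact ((hhx.mul hx'cont).const_smul (-(1 / 2) : ℝ)).intervalIntegrable_of_Icc htpos.le
    · exact (hhx.mul (hx'cont.pow 2)).intervalIntegrable_of_Icc htpos.le
    · have hlt := (hx'bound s (Set.Ioo_subset_Ioc_self hs)).2
      have hsq : -(1 / 2) * x' s ≤ x' s ^ 2 := by nlinarith
      linarith [mul_le_mul_of_nonneg_left hsq (hnn (x s))]
  set n := ⌊t / (2 * T)⌋₊
  have hn_le : (n : ℝ) * T ≤ t / 2 := by
    have := Nat.floor_le (show 0 ≤ t / (2 * T) by positivity)
    rw [le_div_iff₀ (by positivity)] at this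
    linarith
  have hn_ge : t / (4 * T) ≤ n := by
    have := Nat.lt_floor_add_one (t / (2 * T))
    rw [div_lt_iff₀ (by positivity)] at this
    rw [div_le_iff₀ (by positivity)]
    linarith
  have hperiods := nat_mul_integral_le_of_periodic (a := x t) (b := x 0) (n := n) hcont hnn hT.le
    hper (by linarith)
  rw [← hη] at hperiods
  rw [one_div, inv_mul_eq_div, le_div_iff₀ htpos]
  have hcount : t / (4 * T) * η ≤ n * η := mul_le_mul_of_nonneg_right hn_ge hηpos.le
  have hscale : η / (16 * T) * t = (1 / 4) * (t / (4 * T) * η) := by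
    field_simp
    norm_num
  have hpos : 0 ≤ t / (4 * T) * η := by positivity
  linarith
end

section
/- Let 0 < C₁ < C₂, let a : [0,∞) → ℝ be continuous with C₁/2 < a(t) < C₂/2 for all t ≥ 0, and let x : [0,∞) → ℝ be twice continuously differentiable with x″(t) = a(t)·(1 − x′(t)²) for all t ≥ 0 and |x′(0)| ≤ 1. Let h : ℝ → ℝ be a continuous, nonnegative function that is periodic with period T > 0, and set η = ∫₀ᵀ h(s) ds; assume η > 0. Put A = (2/C₁)·log 3. Then for every t > 4T + max{A + 4T, 2A}, (1/t)·∫₀ᵗ h(x(s))·x′(s)² ds ≥ min{η/(64T), η/(4(8T + 2A))}. -/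
open intervalIntegral

/-- The integral of a nonnegative periodic function over `[u, v]` is at least its integral over
one period times the number of periods in `[u, v]`, up to one period. -/
lemma Function.Periodic.mul_sub_one_le_intervalIntegral {h : ℝ → ℝ} {T : ℝ} (hT : 0 < T)
    (hcont : Continuous h) (hnn : ∀ u, 0 ≤ h u) (hper : Function.Periodic h T)
    {u v : ℝ} :
    (∫ s in (0:ℝ)..T, h s) * ((v - u) / T - 1) ≤ ∫ s in u..v, h s := by
  have hint : ∀ a b : ℝ, IntervalIntegrable h MeasureTheory.volume a b :=
    fun a b ↦ hcont.intervalIntegrable a b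
  have hη : 0 ≤ ∫ s in (0:ℝ)..T, h s := integral_nonneg hT.le fun s _ ↦ hnn s
  set n : ℤ := ⌊(v - u) / T⌋
  have hfloor : (v - u) / T - 1 ≤ n := (Int.sub_one_lt_floor _).le
  have hle : u + n • T ≤ v := by
    have h1 : (n : ℝ) ≤ (v - u) / T := Int.floor_le _
    rw [le_div_iff₀ hT] at h1
    rw [zsmul_eq_mul]
    linarith
  have hperiods : ∫ s in u..(u + n • T), h s = n * ∫ s in (0:ℝ)..T, h s := by
    rw [hper.intervalIntegral_add_zsmul_eq n u hint, hper.intervalIntegral_add_eq u 0, zero_add,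
      zsmul_eq_mul]
  have hsplit := integral_add_adjacent_intervals (hint u (u + n • T)) (hint (u + n • T) v)
  have hrest : 0 ≤ ∫ s in (u + n • T)..v, h s := integral_nonneg hle fun s _ ↦ hnn s
  rw [← hsplit, hperiods]
  nlinarith

/-- A solution of `y' = a (1 - y²)` that starts in `[-1, 1]` stays there. -/
lemma sq_le_one_of_hasDerivAt_mul_one_sub_sq {a y : ℝ → ℝ} (ha : ContinuousOn a (Set.Ici 0))
    (hy : ∀ t, 0 ≤ t → HasDerivAt y (a t * (1 - y t ^ 2)) t) (hy0 : |y 0| ≤ 1)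
    {t : ℝ} (ht : 0 ≤ t) : y t ^ 2 ≤ 1 := by
  have hyc : ContinuousOn y (Set.Ici 0) := fun s hs ↦ (hy s hs).continuousAt.continuousWithinAt
  have hmax : Continuous fun s : ℝ ↦ max 0 s := continuous_const.max continuous_id
  have hbc : Continuous fun s : ℝ ↦ 2 * y (max 0 s) * a (max 0 s) :=
    (continuous_const.mul (hyc.comp_continuous hmax fun s ↦ le_max_left 0 s)).mul
      (ha.comp_continuous hmax fun s ↦ le_max_left 0 s)
  set G : ℝ → ℝ := fun s ↦ ∫ r in (0:ℝ)..s, 2 * y (max 0 r) * a (max 0 r) with hG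
  have hGd : ∀ s, 0 ≤ s → HasDerivAt G (2 * y s * a s) s := fun s hs ↦ by
    have := integral_hasDerivAt_right (hbc.intervalIntegrable 0 s)
      (hbc.stronglyMeasurableAtFilter _ _) hbc.continuousAt
    rwa [max_eq_right hs] at this
  have hd : ∀ s, 0 ≤ s → HasDerivAt (fun s ↦ (1 - y s ^ 2) * Real.exp (G s)) 0 s := fun s hs ↦ by
    refine ((((hy s hs).fun_pow 2).const_sub 1).fun_mul (hGd s hs).exp).congr_deriv ?_
    push_cast
    ring
  have hconst := constant_of_has_deriv_right_zero (a := 0) (b := t)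
    (fun s hs ↦ (hd s hs.1).continuousAt.continuousWithinAt)
    (fun s hs ↦ (hd s hs.1).hasDerivWithinAt) t ⟨ht, le_rfl⟩
  have hG0 : G 0 = 0 := by simp [hG]
  have h0 : y 0 ^ 2 ≤ 1 := (sq_le_one_iff_abs_le_one _).2 hy0
  simp only [hG0, Real.exp_zero, mul_one] at hconst
  have := Real.exp_pos (G t)
  by_contra! hlt
  nlinarith

/-- A solution of `y' = a (1 - y²)` with `a ≥ C / 2` crosses `[-1/2, 1/2]` in time at most
`(2 / C) log 3`. -/
lemma mul_sub_le_two_mul_log_three {C p q : ℝ} {a y : ℝ → ℝ} (hpq : p ≤ q)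
    (ha : ∀ t ∈ Set.Icc p q, C / 2 ≤ a t)
    (hy : ∀ t ∈ Set.Icc p q, HasDerivAt y (a t * (1 - y t ^ 2)) t)
    (hyhalf : ∀ t ∈ Set.Icc p q, -(1 / 2) ≤ y t ∧ y t ≤ 1 / 2) :
    C * (q - p) ≤ 2 * Real.log 3 := by
  have hd : ∀ s ∈ Set.Icc p q,
      HasDerivAt (fun s ↦ Real.log (1 + y s) - Real.log (1 - y s)) (2 * a s) s := fun s hs ↦ by
    have hpos : 0 < 1 + y s := by linarith [(hyhalf s hs).1]
    have hneg : 0 < 1 - y s := by linarith [(hyhalf s hs).2]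
    refine ((((hy s hs).const_add 1).log hpos.ne').fun_sub
      (((hy s hs).const_sub 1).log hneg.ne')).congr_deriv ?_
    rw [show 1 - y s ^ 2 = (1 + y s) * (1 - y s) by ring]
    field_simp
    ring
  have hmvt := (convex_Icc p q).mul_sub_le_image_sub_of_le_deriv (C := C)
    (fun s hs ↦ (hd s hs).continuousAt.continuousWithinAt)
    (fun s hs ↦ (hd s (interior_subset hs)).differentiableAt.differentiableWithinAt)
    (fun s hs ↦ by
      rw [(hd s (interior_subset hs)).deriv]
      linarith [ha s (interior_subset hs)])
    p ⟨le_rfl, hpq⟩ q ⟨hpq, le_rfl⟩ hpq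
  obtain ⟨hp1, hp2⟩ := hyhalf p ⟨le_rfl, hpq⟩
  obtain ⟨hq1, hq2⟩ := hyhalf q ⟨hpq, le_rfl⟩
  have e1 : Real.log (1 + y q) ≤ Real.log (3 / 2) := Real.log_le_log (by linarith) (by linarith)
  have e2 : Real.log (1 / 2) ≤ Real.log (1 - y q) := Real.log_le_log (by norm_num) (by linarith)
  have e3 : Real.log (1 / 2) ≤ Real.log (1 + y p) := Real.log_le_log (by norm_num) (by linarith)
  have e4 : Real.log (1 - y p) ≤ Real.log (3 / 2) := Real.log_le_log (by linarith) (by linarith)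
  have e5 : Real.log (3 / 2) - Real.log (1 / 2) = Real.log 3 := by
    rw [← Real.log_div (by norm_num) (by norm_num)]
    norm_num
  linarith

/-- A monotone function on `[0, t]` crosses each level at some point of `[0, t]`. -/
lemma MonotoneOn.exists_crossing {f : ℝ → ℝ} {t : ℝ} (ht : 0 ≤ t)
    (hf : MonotoneOn f (Set.Ici 0)) (c : ℝ) :
    ∃ p ∈ Set.Icc 0 t, (∀ s ∈ Set.Ioo 0 p, f s ≤ c) ∧ ∀ s ∈ Set.Ioo p t, c ≤ f s := by
  set S : Set ℝ := {s | s ∈ Set.Icc 0 t ∧ f s < c}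
  have hbdd : BddAbove S := ⟨t, fun s hs ↦ hs.1.2⟩
  rcases S.eq_empty_or_nonempty with hS | hS
  · refine ⟨0, ⟨le_rfl, ht⟩, by simp, fun s hs ↦ ?_⟩
    by_contra! hlt
    exact (hS ▸ (⟨⟨hs.1.le, hs.2.le⟩, hlt⟩ : s ∈ S) : s ∈ (∅ : Set ℝ))
  · refine ⟨sSup S, ⟨?_, csSup_le hS fun s hs ↦ hs.1.2⟩, fun s hs ↦ ?_, fun s hs ↦ ?_⟩
    · obtain ⟨s, hs⟩ := hS
      exact hs.1.1.trans (le_csSup hbdd hs)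
    · obtain ⟨r, hr, hsr⟩ := exists_lt_of_lt_csSup hS hs.2
      exact (hf hs.1.le hr.1.1 hsr.le).trans hr.2.le
    · by_contra! hlt
      have h0 : 0 ≤ sSup S := by
        obtain ⟨r, hr⟩ := hS
        exact hr.1.1.trans (le_csSup hbdd hr)
      exact absurd (le_csSup hbdd (⟨⟨h0.trans hs.1.le, hs.2.le⟩, hlt⟩ : s ∈ S)) (not_le.2 hs.1)

/-- Lower bound for the integral of `h(x) y²`, with `y = x'`, over a time interval on which
`y ≥ 1/2`. -/
lemma le_integral_comp_mul_sq_of_half_le {h x y : ℝ → ℝ} {T p q : ℝ} (hT : 0 < T)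
    (hcont : Continuous h) (hnn : ∀ u, 0 ≤ h u) (hper : Function.Periodic h T) (hpq : p ≤ q)
    (hx : ∀ s ∈ Set.Icc p q, HasDerivAt x (y s) s) (hy : ContinuousOn y (Set.Icc p q))
    (hhalf : ∀ s ∈ Set.Ioo p q, 1 / 2 ≤ y s) :
    (∫ s in (0:ℝ)..T, h s) * ((q - p) / (2 * T) - 1) / 2 ≤ ∫ s in p..q, h (x s) * y s ^ 2 := by
  have hxc : ContinuousOn x (Set.Icc p q) := fun s hs ↦ (hx s hs).continuousAt.continuousWithinAt
  have hhx : ContinuousOn (fun s ↦ h (x s)) (Set.Icc p q) := hcont.comp_continuousOn hxc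
  have hη : 0 ≤ ∫ s in (0:ℝ)..T, h s := integral_nonneg hT.le fun s _ ↦ hnn s
  have hdisp : 1 / 2 * (q - p) ≤ x q - x p :=
    (convex_Icc p q).mul_sub_le_image_sub_of_le_deriv hxc
      (fun s hs ↦ (hx s (interior_subset hs)).differentiableAt.differentiableWithinAt)
      (fun s hs ↦ by
        rw [(hx s (interior_subset hs)).deriv]
        exact hhalf s (by rwa [interior_Icc] at hs))
      p ⟨le_rfl, hpq⟩ q ⟨hpq, le_rfl⟩ hpq
  have hsubst : ∫ s in p..q, h (x s) * y s = ∫ u in x p..x q, h u :=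
    integral_comp_mul_deriv (by rwa [Set.uIcc_of_le hpq]) (by rwa [Set.uIcc_of_le hpq]) hcont
  have hmono : ∫ s in p..q, h (x s) * y s * (1 / 2) ≤ ∫ s in p..q, h (x s) * y s ^ 2 := by
    refine integral_mono_on_of_le_Ioo hpq
      (((hhx.mul hy).mul continuousOn_const).intervalIntegrable_of_Icc hpq)
      ((hhx.mul (hy.pow 2)).intervalIntegrable_of_Icc hpq) fun s hs ↦ ?_
    have hs2 : y s * (1 / 2) ≤ y s ^ 2 := by nlinarith [hhalf s hs]
    rw [mul_assoc]
    exact mul_le_mul_of_nonneg_left hs2 (hnn _)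
  rw [integral_mul_const, hsubst] at hmono
  have hlow := hper.mul_sub_one_le_intervalIntegral hT hcont hnn (u := x p) (v := x q)
  have hdiv : (q - p) / (2 * T) ≤ (x q - x p) / T := by
    rw [div_le_div_iff₀ (by positivity) hT]
    nlinarith
  nlinarith [mul_le_mul_of_nonneg_left (sub_le_sub_right hdiv 1) hη]

/-- Lower bound for the integral of `h(x) y²`, with `y = x'`, over a time interval on which
`y ≤ -1/2`. -/
lemma le_integral_comp_mul_sq_of_le_neg_half {h x y : ℝ → ℝ} {T p q : ℝ} (hT : 0 < T)
    (hcont : Continuous h) (hnn : ∀ u, 0 ≤ h u) (hper : Function.Periodic h T) (hpq : p ≤ q)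
    (hx : ∀ s ∈ Set.Icc p q, HasDerivAt x (y s) s) (hy : ContinuousOn y (Set.Icc p q))
    (hhalf : ∀ s ∈ Set.Ioo p q, y s ≤ -(1 / 2)) :
    (∫ s in (0:ℝ)..T, h s) * ((q - p) / (2 * T) - 1) / 2 ≤ ∫ s in p..q, h (x s) * y s ^ 2 := by
  have hper' : Function.Periodic (fun u ↦ h (-u)) T := fun u ↦ by
    show h (-(u + T)) = h (-u)
    rw [← hper (-(u + T))]
    ring_nf
  have hflip := le_integral_comp_mul_sq_of_half_le (h := fun u ↦ h (-u)) (x := fun s ↦ -x s)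
    (y := fun s ↦ -y s) hT (hcont.comp continuous_neg) (fun u ↦ hnn _) hper' hpq
    (fun s hs ↦ (hx s hs).neg) hy.neg (fun s hs ↦ by linarith [hhalf s hs])
  have hη : ∫ s in (0:ℝ)..T, h (-s) = ∫ s in (0:ℝ)..T, h s := by
    rw [integral_comp_neg]
    simpa using hper.intervalIntegral_add_eq (-T) 0
  simpa only [hη, neg_neg, neg_sq] using hflip

/-- Main estimate of Section 4.2: along any solution of `x'' = a(t)(1 - (x')²)` with
`C₁/2 < a < C₂/2` and `|x'(0)| ≤ 1`, the time-average of `h(x(s)) x'(s)²` is uniformly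
bounded below for all large `t`. -/
theorem main_warped_product_average_estimate
    (C₁ C₂ : ℝ) (hC₁ : 0 < C₁) (hC : C₁ < C₂)
    (a x x' x'' : ℝ → ℝ)
    (hacont : ContinuousOn a (Set.Ici 0))
    (habound : ∀ t : ℝ, 0 ≤ t → C₁ / 2 < a t ∧ a t < C₂ / 2)
    (hx : ∀ t : ℝ, 0 ≤ t → HasDerivAt x (x' t) t)
    (hx' : ∀ t : ℝ, 0 ≤ t → HasDerivAt x' (x'' t) t)
    (hx''cont : ContinuousOn x'' (Set.Ici 0))
    (hode : ∀ t : ℝ, 0 ≤ t → x'' t = a t * (1 - (x' t) ^ 2))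
    (hx'0 : |x' 0| ≤ 1)
    (h : ℝ → ℝ) (T : ℝ) (hT : 0 < T)
    (hcont : Continuous h) (hnn : ∀ u : ℝ, 0 ≤ h u)
    (hper : Function.Periodic h T)
    (η : ℝ) (hη : η = ∫ s in (0:ℝ)..T, h s) (hηpos : 0 < η)
    (A : ℝ) (hA : A = (2 / C₁) * Real.log 3) :
    ∀ t : ℝ, 4 * T + max (A + 4 * T) (2 * A) < t →
      min (η / (64 * T)) (η / (4 * (8 * T + 2 * A))) ≤
        (1 / t) * ∫ s in (0:ℝ)..t, h (x s) * (x' s) ^ 2 := by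
  intro t ht
  have hlog : 0 < Real.log 3 := Real.log_pos (by norm_num)
  have hApos : 0 < A := by rw [hA]; positivity
  have ht1 : 8 * T + A < t := by linarith [le_max_left (A + 4 * T) (2 * A)]
  have ht2 : 4 * T + 2 * A < t := by linarith [le_max_right (A + 4 * T) (2 * A)]
  have ht0 : 0 < t := by linarith
  have hy : ∀ s, 0 ≤ s → HasDerivAt x' (a s * (1 - x' s ^ 2)) s := fun s hs ↦
    hode s hs ▸ hx' s hs
  have hyc : ContinuousOn x' (Set.Ici 0) := fun s hs ↦ (hx' s hs).continuousAt.continuousWithinAt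
  have hxc : ContinuousOn x (Set.Ici 0) := fun s hs ↦ (hx s hs).continuousAt.continuousWithinAt
  have hmono : MonotoneOn x' (Set.Ici 0) := by
    refine monotoneOn_of_deriv_nonneg (convex_Ici 0) hyc
      (fun s hs ↦ (hy s (interior_subset hs)).differentiableAt.differentiableWithinAt)
      fun s hs ↦ ?_
    have hs0 : 0 ≤ s := interior_subset hs
    rw [(hy s hs0).deriv]
    exact mul_nonneg (by linarith [(habound s hs0).1])
      (sub_nonneg.2 (sq_le_one_of_hasDerivAt_mul_one_sub_sq hacont hy hx'0 hs0))
  obtain ⟨p, hp, hpl, hpr⟩ := hmono.exists_crossing ht0.le (-(1 / 2))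
  obtain ⟨q, hq, hql, hqr⟩ := hmono.exists_crossing ht0.le (1 / 2)
  have hpq : p ≤ q := by
    by_contra! hlt
    obtain ⟨s, hs⟩ := exists_between hlt
    linarith [hpl s ⟨hq.1.trans_lt hs.1, hs.2⟩, hqr s ⟨hs.1, hs.2.trans_le hp.2⟩]
  have hcross : q - p ≤ A := by
    rcases hpq.eq_or_lt with rfl | hlt
    · linarith
    have hclosed : ∀ s ∈ Set.Icc p q, x' s ∈ Set.Icc (-(1 / 2)) (1 / 2) := by
      have hIoo : Set.MapsTo x' (Set.Ioo p q) (Set.Icc (-(1 / 2)) (1 / 2)) := fun s hs ↦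
        ⟨hpr s ⟨hs.1, hs.2.trans_le hq.2⟩, hql s ⟨hp.1.trans_lt hs.1, hs.2⟩⟩
      have hcl := hIoo.closure_of_continuousOn
        (hyc.mono (by rw [closure_Ioo hlt.ne]; exact fun s hs ↦ hp.1.trans hs.1))
      rwa [closure_Ioo hlt.ne, isClosed_Icc.closure_eq] at hcl
    have := mul_sub_le_two_mul_log_three hpq (fun s hs ↦ (habound s (hp.1.trans hs.1)).1.le)
      (fun s hs ↦ hy s (hp.1.trans hs.1)) hclosed
    rw [hA, div_mul_eq_mul_div, le_div_iff₀ hC₁]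
    linarith
  have hleft := le_integral_comp_mul_sq_of_le_neg_half hT hcont hnn hper hp.1
    (fun s hs ↦ hx s hs.1) (hyc.mono Set.Icc_subset_Ici_self) hpl
  have hright := le_integral_comp_mul_sq_of_half_le hT hcont hnn hper hq.2
    (fun s hs ↦ hx s (hq.1.trans hs.1)) (hyc.mono fun s hs ↦ hq.1.trans hs.1) hqr
  have hmid : 0 ≤ ∫ s in p..q, h (x s) * x' s ^ 2 :=
    integral_nonneg hpq fun s _ ↦ mul_nonneg (hnn _) (sq_nonneg _)
  have hint : ∀ u v : ℝ, 0 ≤ u → u ≤ v →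
      IntervalIntegrable (fun s ↦ h (x s) * x' s ^ 2) MeasureTheory.volume u v := fun u v hu huv ↦
    (((hcont.comp_continuousOn hxc).mul (hyc.pow 2)).mono
      fun s hs ↦ hu.trans hs.1).intervalIntegrable_of_Icc huv
  have hsum : ∫ s in (0:ℝ)..t, h (x s) * x' s ^ 2 = (∫ s in (0:ℝ)..p, h (x s) * x' s ^ 2)
      + (∫ s in p..q, h (x s) * x' s ^ 2) + ∫ s in q..t, h (x s) * x' s ^ 2 := by
    rw [integral_add_adjacent_intervals (hint 0 p le_rfl hp.1) (hint p q hp.1 hpq),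
      integral_add_adjacent_intervals (hint 0 q le_rfl hq.1) (hint q t hq.1 hq.2)]
  rw [← hη] at hleft hright
  refine (min_le_left _ _).trans ?_
  rw [one_div_mul_eq_div, le_div_iff₀ ht0, hsum]
  calc η / (64 * T) * t = η * (t / 16) / (4 * T) := by field_simp; norm_num
    _ ≤ η * (p + (t - q) - 4 * T) / (4 * T) := by gcongr; linarith
    _ = η * ((p - 0) / (2 * T) - 1) / 2 + η * ((t - q) / (2 * T) - 1) / 2 := by
      field_simp
      ring
    _ ≤ _ := by linarith
end
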